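/- arXiv:math/0503034 — 4 statements merged into one kernel-verified Lean document; each statement's English description precedes it below -/
import Mathlib

section
/- For every μ ∈ P the master function S_k(μ,·) : V* → ℝ is a smooth function whose second derivative at any point ξ ∈ V* is the symmetric bilinear form B_ξ^k(η,η′) = ⟨η,η′⟩ + (1/2)·Σ_{α∈Σ₀} k_α‖α‖²·η(α∨)η′(α∨)/(k_α² + ξ(α∨)²); this form is positive definite for every ξ ∈ V*, and consequently S_k(μ,·) is strictly convex on V*. -/
open scoped BigOperators
open RealInnerProductSpace

noncomputable section

/-- The coroot `α∨` of a root `α`, under the identification of `V*` with `V`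
via the inner product: `ξ(α∨) = 2⟨ξ,α⟩/‖α‖²`. -/
def coroot {V : Type*} [NormedAddCommGroup V] [InnerProductSpace ℝ V] (α : V) : V :=
  (2 / ‖α‖ ^ 2) • α

/-- The orthogonal reflection `s_α` in the hyperplane orthogonal to `α`:
`s_α(ξ) = ξ − ξ(α∨)·α = ξ − α(ξ)·α∨`. -/
def sRefl {V : Type*} [NormedAddCommGroup V] [InnerProductSpace ℝ V] (α v : V) : V :=
  v - ⟪α, v⟫ • coroot α

/-- A finite, irreducible, reduced, crystallographic root system `Σ₀` in the dual of
the Euclidean space `V` (identified with `V` via the inner product), together with a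
fixed base of simple roots, the positive roots, and the highest root. -/
structure RootSystemBase (V : Type*) [NormedAddCommGroup V] [InnerProductSpace ℝ V]
    [FiniteDimensional ℝ V] where
  roots : Finset V
  roots_nonempty : roots.Nonempty
  ne_zero : ∀ α ∈ roots, α ≠ (0 : V)
  /-- reduced -/
  reduced : ∀ α ∈ roots, ∀ c : ℝ, c • α ∈ roots → c = 1 ∨ c = -1
  /-- crystallographic: `β(α∨) ∈ ℤ` -/
  crystallographic : ∀ α ∈ roots, ∀ β ∈ roots, ∃ m : ℤ, ⟪β, coroot α⟫ = (m : ℝ)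
  /-- stable under the reflections `s_α` -/
  refl_mem : ∀ α ∈ roots, ∀ β ∈ roots, sRefl α β ∈ roots
  /-- `Σ₀` spans `V*` -/
  spanning : Submodule.span ℝ (roots : Set V) = ⊤
  /-- irreducible: no nontrivial orthogonal decomposition -/
  irreducible : ∀ s : Finset V, s ⊆ roots →
    (∀ α ∈ s, ∀ β ∈ roots, β ∉ s → ⟪α, β⟫ = 0) → s = ∅ ∨ s = roots
  /-- the fixed base of simple roots -/
  simples : Finset V
  simples_sub : simples ⊆ roots
  simples_indep : LinearIndependent ℝ (fun β : {x // x ∈ simples} => (β : V))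
  /-- the positive roots w.r.t. the base -/
  pos : Finset V
  pos_sub : pos ⊆ roots
  simples_sub_pos : simples ⊆ pos
  pos_or_neg : ∀ α ∈ roots, (α ∈ pos ∧ -α ∉ pos) ∨ (α ∉ pos ∧ -α ∈ pos)
  pos_combo : ∀ α ∈ pos, ∃ c : V → ℝ, (∀ β, 0 ≤ c β) ∧ α = ∑ β ∈ simples, c β • β
  /-- the highest root `φ` -/
  hroot : V
  hroot_pos : hroot ∈ pos
  hroot_highest : ∀ α ∈ roots, ∃ c : V → ℝ, (∀ β, 0 ≤ c β) ∧
    hroot - α = ∑ β ∈ simples, c β • β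

variable {V : Type*} [NormedAddCommGroup V] [InnerProductSpace ℝ V] [FiniteDimensional ℝ V]

/-- The Weyl group `W₀`: the subgroup of linear automorphisms of `V` generated by the
orthogonal reflections in the roots. -/
def weylGroup (R : RootSystemBase V) : Subgroup (V ≃ₗ[ℝ] V) :=
  Subgroup.closure {w : V ≃ₗ[ℝ] V | ∃ α ∈ R.roots, ∀ v, w v = sRefl α v}

/-- A strictly positive `W₀`-invariant multiplicity function. -/
def IsMultiplicity (R : RootSystemBase V) (k : V → ℝ) : Prop :=
  (∀ α ∈ R.roots, 0 < k α) ∧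
  (∀ w : V ≃ₗ[ℝ] V, w ∈ weylGroup R → ∀ α ∈ R.roots, k (w α) = k α)

/-- `σ_η^k = Σ_{α∈Σ₀} arctan(η(α∨)/k_α)·α`. -/
def sigmaFun (R : RootSystemBase V) (k : V → ℝ) (η : V) : V :=
  ∑ α ∈ R.roots, Real.arctan (⟪η, coroot α⟫ / k α) • α

/-- The master function
`S_k(μ,ξ) = ½‖ξ‖² − 2π⟨μ,ξ⟩ + ½ Σ_{α∈Σ₀} ‖α‖² ∫₀^{ξ(α∨)} arctan(t/k_α) dt`. -/
def masterFun (R : RootSystemBase V) (k : V → ℝ) (μ ξ : V) : ℝ :=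
  ‖ξ‖ ^ 2 / 2 - 2 * Real.pi * ⟪μ, ξ⟫ +
    (1 / 2) * ∑ α ∈ R.roots, ‖α‖ ^ 2 * ∫ t in (0:ℝ)..(⟪ξ, coroot α⟫), Real.arctan (t / k α)

/-- Membership in the weight lattice `P = {λ ∈ V* : λ(α∨) ∈ ℤ ∀α ∈ Σ₀}`. -/
def IsWeight (R : RootSystemBase V) (lam : V) : Prop :=
  ∀ α ∈ R.roots, ∃ m : ℤ, ⟪lam, coroot α⟫ = (m : ℝ)

/-- `η ∈ V*` is a Bethe root: `λ = iη` solves the Bethe ansatz equations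
`e^{(wλ)(φ∨)} = ∏_{α∈Σ₀⁺} ((wλ)(α∨) − k_α)/((wλ)(α∨) + k_α))^{α(φ∨)}` for all `w ∈ W₀`,
where `m α = α(φ∨) ∈ ℤ≥0`. -/
def IsBetheRoot (R : RootSystemBase V) (k : V → ℝ) (m : V → ℕ) (η : V) : Prop :=
  ∀ w : V ≃ₗ[ℝ] V, w ∈ weylGroup R →
    Complex.exp (Complex.I * (⟪w η, coroot R.hroot⟫ : ℝ)) =
      ∏ α ∈ R.pos,
        ((Complex.I * (⟪w η, coroot α⟫ : ℝ) - (k α : ℂ)) /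
         (Complex.I * (⟪w η, coroot α⟫ : ℝ) + (k α : ℂ))) ^ (m α)

end

section

theorem hasFDerivAt_inner_left {E : Type*} [NormedAddCommGroup E]
    [InnerProductSpace ℝ E] (v ξ : E) :
    HasFDerivAt (fun x : E => ⟪x, v⟫) (innerSL ℝ v) ξ := by
  rw [show (fun x : E => ⟪x, v⟫) = innerSL ℝ v from funext fun x => real_inner_comm _ _]
  exact (innerSL ℝ v).hasFDerivAt

/-- The function `x ↦ ∫₀ˣ arctan(t/a) dt`. -/
noncomputable def arctanPrimitive (a x : ℝ) : ℝ := ∫ t in (0:ℝ)..x, Real.arctan (t / a)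

theorem hasDerivAt_arctanPrimitive (a x : ℝ) :
    HasDerivAt (arctanPrimitive a) (Real.arctan (x / a)) x := by
  have hc : Continuous fun t : ℝ => Real.arctan (t / a) :=
    Real.continuous_arctan.comp (continuous_id.div_const a)
  exact intervalIntegral.integral_hasDerivAt_right (hc.intervalIntegrable _ _)
    (hc.stronglyMeasurableAtFilter _ _) hc.continuousAt

theorem contDiff_arctanPrimitive (a : ℝ) : ContDiff ℝ (⊤ : ℕ∞) (arctanPrimitive a) := by
  rw [contDiff_infty_iff_deriv]
  refine ⟨fun x => (hasDerivAt_arctanPrimitive a x).differentiableAt, ?_⟩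
  rw [show deriv (arctanPrimitive a) = fun x => Real.arctan (x / a) from
    funext fun x => (hasDerivAt_arctanPrimitive a x).deriv]
  exact Real.contDiff_arctan.comp (contDiff_id.div_const a)

theorem convexOn_arctanPrimitive {a : ℝ} (ha : 0 < a) :
    ConvexOn ℝ Set.univ (arctanPrimitive a) := by
  refine Monotone.convexOn_univ_of_deriv
    (fun x => (hasDerivAt_arctanPrimitive a x).differentiableAt) fun x y hxy => ?_
  rw [(hasDerivAt_arctanPrimitive a x).deriv, (hasDerivAt_arctanPrimitive a y).deriv]
  exact Real.arctan_mono (by gcongr)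

theorem hasDerivAt_arctan_div {a : ℝ} (ha : 0 < a) (x : ℝ) :
    HasDerivAt (fun t => Real.arctan (t / a)) (a / (a ^ 2 + x ^ 2)) x := by
  convert ((hasDerivAt_id x).div_const a).arctan using 1
  have : a ^ 2 + x ^ 2 ≠ 0 := by positivity
  simp only [id]
  field_simp
  simp

variable {V : Type*} [NormedAddCommGroup V] [InnerProductSpace ℝ V] [FiniteDimensional ℝ V]

theorem contDiff_masterFun (R : RootSystemBase V) (k : V → ℝ) (μ : V) :
    ContDiff ℝ (⊤ : ℕ∞) (masterFun R k μ) := by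
  refine (((contDiff_norm_sq ℝ).div_const 2).sub
    (contDiff_const.mul (contDiff_const.inner ℝ contDiff_id))).add
    (contDiff_const.mul (ContDiff.sum fun α _ => contDiff_const.mul ?_))
  exact (contDiff_arctanPrimitive (k α)).comp (contDiff_id.inner ℝ contDiff_const)

theorem hasFDerivAt_masterFun (R : RootSystemBase V) (k : V → ℝ) (μ ξ : V) :
    HasFDerivAt (masterFun R k μ)
      (innerSL ℝ ξ - (2 * Real.pi) • innerSL ℝ μ + (1 / 2 : ℝ) • ∑ α ∈ R.roots,
        ‖α‖ ^ 2 • Real.arctan (⟪ξ, coroot α⟫ / k α) • innerSL ℝ (coroot α)) ξ := by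
  have hnorm : HasFDerivAt (fun x : V => ‖x‖ ^ 2 / 2) (innerSL ℝ ξ) ξ := by
    have h := (hasStrictFDerivAt_norm_sq ξ).hasFDerivAt.const_mul (2⁻¹ : ℝ)
    rw [show (fun x : V => ‖x‖ ^ 2 / 2) = fun x => 2⁻¹ * ‖x‖ ^ 2 from funext fun x => by ring]
    exact h.congr_fderiv (by ext x; simp)
  refine (hnorm.sub ((innerSL ℝ μ).hasFDerivAt.const_mul (2 * Real.pi))).add
    ((HasFDerivAt.fun_sum fun α _ => HasFDerivAt.const_mul ?_ (‖α‖ ^ 2)).const_mul (1 / 2 : ℝ))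
  exact (hasDerivAt_arctanPrimitive (k α) _).comp_hasFDerivAt ξ
    (hasFDerivAt_inner_left (coroot α) ξ)

theorem iteratedFDeriv_two_masterFun (R : RootSystemBase V) {k : V → ℝ}
    (hk : ∀ α ∈ R.roots, 0 < k α) (μ ξ η η' : V) :
    (iteratedFDeriv ℝ 2 (masterFun R k μ) ξ) ![η, η'] =
      ⟪η, η'⟫ + (1 / 2) * ∑ α ∈ R.roots,
        k α * ‖α‖ ^ 2 * (⟪η, coroot α⟫ * ⟪η', coroot α⟫) /
          ((k α) ^ 2 + (⟪ξ, coroot α⟫ : ℝ) ^ 2) := by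
  rw [iteratedFDeriv_two_apply, funext fun x => (hasFDerivAt_masterFun R k μ x).fderiv]
  have h := (((innerSL ℝ (E := V)).hasFDerivAt (x := ξ)).sub_const
    ((2 * Real.pi) • innerSL ℝ μ)).add ((HasFDerivAt.fun_sum (u := R.roots) fun α hα =>
      ((((hasDerivAt_arctan_div (hk α hα) _).comp_hasFDerivAt ξ
        (hasFDerivAt_inner_left (coroot α) ξ)).smul_const
          (innerSL ℝ (coroot α))).const_smul (‖α‖ ^ 2))).const_smul (1 / 2 : ℝ))
  refine (congrArg (fun L : V →L[ℝ] V →L[ℝ] ℝ => L η η') h.fderiv).trans ?_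
  have key : ∀ α ∈ R.roots, ‖α‖ ^ 2 * (k α / (k α ^ 2 + ⟪ξ, coroot α⟫ ^ 2) *
        ⟪η, coroot α⟫ * ⟪η', coroot α⟫) =
      k α * ‖α‖ ^ 2 * (⟪η, coroot α⟫ * ⟪η', coroot α⟫) / (k α ^ 2 + ⟪ξ, coroot α⟫ ^ 2) :=
    fun α _ => by ring
  rw [← Finset.sum_congr rfl key]
  simp [real_inner_comm]
  rfl

theorem strictConvexOn_masterFun (R : RootSystemBase V) {k : V → ℝ}
    (hk : ∀ α ∈ R.roots, 0 < k α) (μ : V) :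
    StrictConvexOn ℝ Set.univ (masterFun R k μ) := by
  refine StrongConvexOn.strictConvexOn (m := 1) ?_ one_pos
  rw [strongConvexOn_iff_convex]
  have hlin : ConvexOn ℝ Set.univ (fun ξ : V => -(2 * Real.pi) * ⟪μ, ξ⟫) :=
    ((-(2 * Real.pi)) • innerₛₗ ℝ μ).convexOn convex_univ
  have hsum : ConvexOn ℝ Set.univ (fun ξ : V => ∑ α ∈ R.roots,
      ‖α‖ ^ 2 * arctanPrimitive (k α) ⟪ξ, coroot α⟫) := by
    rw [← Finset.sum_fn]
    refine Finset.sum_induction _ (ConvexOn ℝ Set.univ) (fun _ _ => ConvexOn.add)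
      (convexOn_const 0 convex_univ) fun α hα => ?_
    have h := ((convexOn_arctanPrimitive (hk α hα)).comp_linearMap
      (innerₛₗ ℝ (coroot α))).smul (sq_nonneg ‖α‖)
    simpa [Function.comp_def, real_inner_comm] using h
  refine (hlin.add (hsum.smul (by norm_num : (0 : ℝ) ≤ 1 / 2))).congr fun ξ _ => ?_
  simp only [masterFun, arctanPrimitive, Pi.add_apply, smul_eq_mul]
  ring

end

noncomputable section

/-- For every weight `μ ∈ P` the master function `S_k(μ,·)` is smooth,
its second derivative at any `ξ` is the symmetric bilinear form
`B_ξ^k(η,η′) = ⟨η,η′⟩ + ½ Σ_{α∈Σ₀} k_α‖α‖² η(α∨)η′(α∨)/(k_α² + ξ(α∨)²)`,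
this form is positive definite for every `ξ`, and `S_k(μ,·)` is strictly convex. -/
theorem statement0
    {V : Type*} [NormedAddCommGroup V] [InnerProductSpace ℝ V] [FiniteDimensional ℝ V]
    (R : RootSystemBase V) (k : V → ℝ) (hk : IsMultiplicity R k)
    (μ : V) (hμ : IsWeight R μ) :
    ContDiff ℝ (⊤ : ℕ∞) (masterFun R k μ) ∧
    (∀ ξ η η' : V,
      (iteratedFDeriv ℝ 2 (masterFun R k μ) ξ) ![η, η'] =
        ⟪η, η'⟫ + (1 / 2) * ∑ α ∈ R.roots,
          k α * ‖α‖ ^ 2 * (⟪η, coroot α⟫ * ⟪η', coroot α⟫) /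
            ((k α) ^ 2 + (⟪ξ, coroot α⟫ : ℝ) ^ 2)) ∧
    (∀ ξ η : V, η ≠ 0 →
      0 < ⟪η, η⟫ + (1 / 2) * ∑ α ∈ R.roots,
          k α * ‖α‖ ^ 2 * (⟪η, coroot α⟫ * ⟪η, coroot α⟫) /
            ((k α) ^ 2 + (⟪ξ, coroot α⟫ : ℝ) ^ 2)) ∧
    StrictConvexOn ℝ Set.univ (masterFun R k μ) := by
  refine ⟨contDiff_masterFun R k μ, iteratedFDeriv_two_masterFun R hk.1 μ,
    fun ξ η hη => add_pos_of_pos_of_nonneg (real_inner_self_pos.2 hη) ?_,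
    strictConvexOn_masterFun R hk.1 μ⟩
  refine mul_nonneg (by norm_num) (Finset.sum_nonneg fun α hα => ?_)
  have := hk.1 α hα
  have := mul_self_nonneg (⟪η, coroot α⟫ : ℝ)
  positivity

end
end

section
/- For every μ ∈ P the master function S_k(μ,·) attains a unique global minimum at a point μ̂ ∈ V*; this μ̂ is the unique critical point of S_k(μ,·), and it is the unique solution η ∈ V* of the equation η + σ_η^k = 2πμ. -/
open scoped BigOperators
open RealInnerProductSpace

noncomputable section

/-- The primitive of the increasing function `t ↦ arctan (t / k)` lies above its tangents. -/
lemma integral_arctan_div_tangent_le {k : ℝ} (hk : 0 < k) (a b : ℝ) :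
    (∫ t in (0:ℝ)..a, Real.arctan (t / k)) + Real.arctan (a / k) * (b - a) ≤
      ∫ t in (0:ℝ)..b, Real.arctan (t / k) := by
  have hc : Continuous fun t : ℝ => Real.arctan (t / k) := by fun_prop
  have hmono : ∀ {x y : ℝ}, x ≤ y → Real.arctan (x / k) ≤ Real.arctan (y / k) := fun h =>
    Real.arctan_mono (div_le_div_of_nonneg_right h hk.le)
  rw [← intervalIntegral.integral_add_adjacent_intervals (hc.intervalIntegrable 0 a)
    (hc.intervalIntegrable a b)]
  gcongr
  rcases le_total a b with h | h
  · have := intervalIntegral.integral_mono_on h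
      (intervalIntegrable_const (c := Real.arctan (a / k)) (μ := MeasureTheory.volume))
      (hc.intervalIntegrable a b) fun x hx => hmono hx.1
    rw [intervalIntegral.integral_const, smul_eq_mul] at this
    linarith
  · have := intervalIntegral.integral_mono_on h (hc.intervalIntegrable b a)
      (intervalIntegrable_const (c := Real.arctan (a / k)) (μ := MeasureTheory.volume))
      fun x hx => hmono hx.2
    rw [intervalIntegral.integral_const, smul_eq_mul] at this
    rw [intervalIntegral.integral_symm]
    linarith

section

variable {V : Type*} [NormedAddCommGroup V] [InnerProductSpace ℝ V]

lemma norm_sq_mul_inner_coroot {α : V} (hα : α ≠ 0) (x : V) :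
    ‖α‖ ^ 2 * ⟪x, coroot α⟫ = 2 * ⟪x, α⟫ := by
  have : ‖α‖ ≠ 0 := norm_ne_zero_iff.mpr hα
  rw [coroot, inner_smul_right]
  field_simp

variable [FiniteDimensional ℝ V]

/-- The gradient of the master function. -/
def masterGrad (R : RootSystemBase V) (k : V → ℝ) (μ ξ : V) : V :=
  ξ + sigmaFun R k ξ - (2 * Real.pi) • μ

lemma inner_masterGrad (R : RootSystemBase V) (k : V → ℝ) (μ ξ x : V) :
    ⟪masterGrad R k μ ξ, x⟫ = ⟪ξ, x⟫ - 2 * Real.pi * ⟪μ, x⟫ +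
      (1 / 2) * ∑ α ∈ R.roots, ‖α‖ ^ 2 * (Real.arctan (⟪ξ, coroot α⟫ / k α) * ⟪x, coroot α⟫) := by
  have h : ∑ α ∈ R.roots, ‖α‖ ^ 2 * (Real.arctan (⟪ξ, coroot α⟫ / k α) * ⟪x, coroot α⟫) =
      2 * ⟪sigmaFun R k ξ, x⟫ := by
    rw [sigmaFun, sum_inner, Finset.mul_sum]
    refine Finset.sum_congr rfl fun α hα => ?_
    rw [real_inner_smul_left, mul_left_comm, norm_sq_mul_inner_coroot (R.ne_zero α hα),
      real_inner_comm α x]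
    ring
  rw [h, masterGrad, inner_sub_left, inner_add_left, real_inner_smul_left]
  ring

/-- The master function is strongly convex. -/
lemma masterFun_strong_convexity (R : RootSystemBase V) {k : V → ℝ}
    (hk : ∀ α ∈ R.roots, 0 < k α) (μ η ξ : V) :
    masterFun R k μ η + ⟪masterGrad R k μ η, ξ - η⟫ + ‖ξ - η‖ ^ 2 / 2 ≤ masterFun R k μ ξ := by
  have h : (∑ α ∈ R.roots, ‖α‖ ^ 2 * ∫ t in (0:ℝ)..⟪η, coroot α⟫, Real.arctan (t / k α)) +
      ∑ α ∈ R.roots, ‖α‖ ^ 2 * (Real.arctan (⟪η, coroot α⟫ / k α) * ⟪ξ - η, coroot α⟫) ≤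
      ∑ α ∈ R.roots, ‖α‖ ^ 2 * ∫ t in (0:ℝ)..⟪ξ, coroot α⟫, Real.arctan (t / k α) := by
    rw [← Finset.sum_add_distrib]
    refine Finset.sum_le_sum fun α hα => ?_
    rw [← mul_add, inner_sub_left]
    exact mul_le_mul_of_nonneg_left
      (integral_arctan_div_tangent_le (hk α hα) _ _) (by positivity)
  rw [inner_masterGrad, norm_sub_sq_real, inner_sub_right, inner_sub_right,
    real_inner_self_eq_norm_sq, real_inner_comm η ξ, masterFun, masterFun]
  linarith

lemma hasFDerivAt_masterFun_s1 (R : RootSystemBase V) (k : V → ℝ) (μ ξ : V) :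
    HasFDerivAt (masterFun R k μ) (innerSL ℝ (masterGrad R k μ ξ)) ξ := by
  have hint : ∀ α ∈ R.roots, HasFDerivAt
      (fun x : V => ‖α‖ ^ 2 * ∫ t in (0:ℝ)..⟪x, coroot α⟫, Real.arctan (t / k α))
      (‖α‖ ^ 2 • Real.arctan (⟪ξ, coroot α⟫ / k α) • innerSL ℝ (coroot α)) ξ := by
    intro α _
    have hc : Continuous fun t : ℝ => Real.arctan (t / k α) := by fun_prop
    have hin : HasFDerivAt (fun x : V => ⟪x, coroot α⟫) (innerSL ℝ (coroot α)) ξ := by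
      have h : (fun x : V => ⟪x, coroot α⟫) = innerSL ℝ (coroot α) :=
        funext fun x => real_inner_comm _ _
      exact h ▸ (innerSL ℝ (coroot α)).hasFDerivAt
    exact (((hc.integral_hasStrictDerivAt 0 _).hasDerivAt).comp_hasFDerivAt ξ hin).const_mul _
  have hμ : HasFDerivAt (fun x : V => ⟪μ, x⟫) (innerSL ℝ μ) ξ := (innerSL ℝ μ).hasFDerivAt
  have hsq : HasFDerivAt (fun x : V => ‖x‖ ^ 2) (2 • innerSL ℝ ξ) ξ :=
    (hasStrictFDerivAt_norm_sq ξ).hasFDerivAt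
  refine ((((hsq.mul_const (1 / 2 : ℝ)).sub (hμ.const_mul (2 * Real.pi))).add
    ((HasFDerivAt.fun_sum hint).const_mul (1 / 2 : ℝ))).congr_fderiv ?_).congr_of_eventuallyEq
    (Filter.Eventually.of_forall fun x => ?_)
  · ext x
    rw [innerSL_apply_apply, inner_masterGrad]
    simp [real_inner_comm x, sum_apply]
  · simp only [masterFun, Pi.add_apply, Pi.sub_apply]
    ring

lemma exists_forall_masterFun_le (R : RootSystemBase V) {k : V → ℝ}
    (hk : ∀ α ∈ R.roots, 0 < k α) (μ : V) :
    ∃ η : V, ∀ ξ : V, masterFun R k μ η ≤ masterFun R k μ ξ := by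
  have hcont : Continuous (masterFun R k μ) :=
    continuous_iff_continuousAt.mpr fun ξ => (hasFDerivAt_masterFun_s1 R k μ ξ).continuousAt
  set g := masterGrad R k μ 0 with hg
  obtain ⟨η, hη, hmin⟩ := (isCompact_closedBall (0 : V) (2 * ‖g‖)).exists_isMinOn
    ⟨0, Metric.mem_closedBall_self (by positivity)⟩ hcont.continuousOn
  refine ⟨η, fun ξ => ?_⟩
  by_cases hξ : ξ ∈ Metric.closedBall (0 : V) (2 * ‖g‖)
  · exact hmin hξ
  have hlt : 2 * ‖g‖ < ‖ξ‖ := by simpa using hξ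
  have h0 : masterFun R k μ η ≤ masterFun R k μ 0 :=
    hmin (Metric.mem_closedBall_self (by positivity))
  have hconv := masterFun_strong_convexity R hk μ 0 ξ
  rw [sub_zero, ← hg] at hconv
  have hcs := (abs_le.mp (abs_real_inner_le_norm g ξ)).1
  nlinarith [norm_nonneg ξ, norm_nonneg g]

end

/-- For every `μ ∈ P` the master function `S_k(μ,·)` attains a unique
global minimum at a point `μ̂ ∈ V*`, which is also its unique critical point, and the
unique solution `η` of `η + σ_η^k = 2πμ`. -/
theorem statement1
    {V : Type*} [NormedAddCommGroup V] [InnerProductSpace ℝ V] [FiniteDimensional ℝ V]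
    (R : RootSystemBase V) (k : V → ℝ) (hk : IsMultiplicity R k)
    (μ : V) (hμ : IsWeight R μ) :
    ∃ η : V,
      (∀ ξ : V, masterFun R k μ η ≤ masterFun R k μ ξ) ∧
      (∀ ξ : V, (∀ ζ : V, masterFun R k μ ξ ≤ masterFun R k μ ζ) → ξ = η) ∧
      (∀ ξ : V, fderiv ℝ (masterFun R k μ) ξ = 0 ↔ ξ = η) ∧
      (∀ ξ : V, ξ + sigmaFun R k ξ = (2 * Real.pi) • μ ↔ ξ = η) := by
  obtain ⟨η, hη⟩ := exists_forall_masterFun_le R hk.1 μ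
  have hcrit : ∀ ξ : V, fderiv ℝ (masterFun R k μ) ξ = 0 ↔ masterGrad R k μ ξ = 0 := fun ξ => by
    rw [(hasFDerivAt_masterFun_s1 R k μ ξ).fderiv, ← norm_eq_zero, innerSL_apply_norm, norm_eq_zero]
  have hmin : ∀ ξ : V, (∀ ζ : V, masterFun R k μ ξ ≤ masterFun R k μ ζ) →
      masterGrad R k μ ξ = 0 := fun ξ h =>
    (hcrit ξ).mp (IsLocalMin.fderiv_eq_zero (Filter.Eventually.of_forall h))
  have huniq : ∀ ξ : V, masterGrad R k μ ξ = 0 ↔ ξ = η := by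
    refine fun ξ => ⟨fun h => ?_, fun h => h ▸ hmin η hη⟩
    have hconv := masterFun_strong_convexity R hk.1 μ ξ η
    rw [h, inner_zero_left] at hconv
    have hsq : ‖η - ξ‖ ^ 2 = 0 := by
      have hηξ := hη ξ
      have := masterFun_strong_convexity R hk.1 μ η ξ
      rw [hmin η hη, inner_zero_left, norm_sub_rev] at this
      nlinarith [sq_nonneg ‖η - ξ‖]
    exact (sub_eq_zero.mp (norm_eq_zero.mp (pow_eq_zero_iff two_ne_zero |>.mp hsq))).symm
  exact ⟨η, hη, fun ξ h => (huniq ξ).mp (hmin ξ h), fun ξ => (hcrit ξ).trans (huniq ξ),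
    fun ξ => sub_eq_zero.symm.trans (huniq ξ)⟩

end
end

section
/- The map μ ↦ μ̂_k is a bijection from the weight lattice P onto the set BAE_k of Bethe roots, and it is W₀-equivariant: for all w ∈ W₀ and μ ∈ P one has (wμ)^̂_k = w(μ̂_k). -/
open scoped BigOperators
open RealInnerProductSpace

noncomputable section

lemma Complex.I_mul_sub_div_I_mul_add (x : ℝ) {c : ℝ} (hc : 0 < c) :
    (Complex.I * (x : ℝ) - (c : ℂ)) / (Complex.I * (x : ℝ) + (c : ℂ)) =
      -Complex.exp (-(2 * Real.arctan (x / c) : ℝ) * Complex.I) := by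
  set θ := Real.arctan (x / c) with hθ
  have hcos : 0 < Real.cos θ := Real.cos_arctan_pos _
  have hx : x = c / Real.cos θ * Real.sin θ := by
    have : Real.tan θ = x / c := Real.tan_arctan _
    rw [Real.tan_eq_sin_div_cos] at this
    field_simp at this ⊢
    linarith
  have hcc : c = c / Real.cos θ * Real.cos θ := by field_simp
  have hr : c / Real.cos θ ≠ 0 := by positivity
  generalize c / Real.cos θ = r at hx hcc hr
  have hr' : (r : ℂ) ≠ 0 := by exact_mod_cast hr
  have hden : Complex.I * (x : ℝ) + (c : ℂ) = r * Complex.exp (θ * Complex.I) := by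
    rw [hx, hcc, Complex.exp_mul_I]
    push_cast
    ring
  have hnum : Complex.I * (x : ℝ) - (c : ℂ) = -(r * Complex.exp (-θ * Complex.I)) := by
    rw [hx, hcc, Complex.exp_mul_I, Complex.cos_neg, Complex.sin_neg]
    push_cast
    ring
  rw [hden, hnum, div_eq_iff (mul_ne_zero hr' (Complex.exp_ne_zero _)), neg_mul,
    neg_mul, mul_left_comm, ← Complex.exp_add]
  congr 3
  push_cast
  ring

section

variable {V : Type*} [NormedAddCommGroup V] [InnerProductSpace ℝ V]

lemma inner_coroot (v α : V) : ⟪v, coroot α⟫ = 2 / ‖α‖ ^ 2 * ⟪v, α⟫ := by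
  simp [coroot, inner_smul_right]

lemma inner_coroot_self {α : V} (h : α ≠ 0) : ⟪α, coroot α⟫ = 2 := by
  have : ‖α‖ ≠ 0 := norm_ne_zero_iff.mpr h
  rw [inner_coroot, real_inner_self_eq_norm_sq]
  field_simp

lemma coroot_neg (α : V) : coroot (-α) = -coroot α := by
  simp [coroot]

lemma inner_sRefl (x α v : V) :
    ⟪x, sRefl α v⟫ = ⟪x, v⟫ - 2 / ‖α‖ ^ 2 * ⟪α, v⟫ * ⟪x, α⟫ := by
  rw [sRefl, inner_sub_right, inner_smul_right, inner_coroot]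
  ring

lemma sRefl_self {α : V} (h : α ≠ 0) : sRefl α α = -α := by
  have : ‖α‖ ≠ 0 := norm_ne_zero_iff.mpr h
  have h2 : ‖α‖ ^ 2 * (2 / ‖α‖ ^ 2) = 2 := by field_simp
  rw [sRefl, real_inner_self_eq_norm_sq, coroot, smul_smul, h2, two_smul]
  abel

lemma sRefl_sRefl {α : V} (h : α ≠ 0) (v : V) : sRefl α (sRefl α v) = v := by
  have h2 : ⟪α, sRefl α v⟫ = -⟪α, v⟫ := by
    rw [sRefl, inner_sub_right, inner_smul_right, inner_coroot_self h]
    ring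
  rw [sRefl, h2, sRefl]
  simp

lemma inner_sRefl_sRefl {α : V} (h : α ≠ 0) (v w : V) :
    ⟪sRefl α v, sRefl α w⟫ = ⟪v, w⟫ := by
  have : ‖α‖ ≠ 0 := norm_ne_zero_iff.mpr h
  rw [inner_sRefl, real_inner_comm, inner_sRefl, real_inner_comm α (sRefl α v), inner_sRefl,
    real_inner_self_eq_norm_sq, real_inner_comm w v, real_inner_comm α w]
  field_simp
  ring

/-- The reflection `s_α` as a linear automorphism. -/
def sReflEquiv {α : V} (h : α ≠ 0) : V ≃ₗ[ℝ] V :=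
  LinearEquiv.ofInvolutive
    { toFun := sRefl α
      map_add' := fun x y => by
        simp only [sRefl, inner_add_right, add_smul]
        abel
      map_smul' := fun c x => by
        simp only [sRefl, inner_smul_right, RingHom.id_apply, smul_sub, smul_smul] }
    (sRefl_sRefl h)

lemma sReflEquiv_apply {α : V} (h : α ≠ 0) (v : V) : sReflEquiv h v = sRefl α v := rfl

namespace RootSystemBase

variable [FiniteDimensional ℝ V] (R : RootSystemBase V)

lemma sReflEquiv_mem {α : V} (h : α ∈ R.roots) : sReflEquiv (R.ne_zero α h) ∈ weylGroup R :=
  Subgroup.subset_closure ⟨α, h, fun _ => rfl⟩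

lemma neg_mem {α : V} (h : α ∈ R.roots) : -α ∈ R.roots := by
  rw [← sRefl_self (R.ne_zero α h)]
  exact R.refl_mem α h α h

lemma hroot_mem : R.hroot ∈ R.roots := R.pos_sub R.hroot_pos

lemma weyl_inner_and_mem {w : V ≃ₗ[ℝ] V} (hw : w ∈ weylGroup R) :
    (∀ x y, ⟪w x, w y⟫ = ⟪x, y⟫) ∧ ∀ α, w α ∈ R.roots ↔ α ∈ R.roots := by
  induction hw using Subgroup.closure_induction with
  | mem w hw =>
    obtain ⟨α, hα, h⟩ := hw
    have h0 := R.ne_zero α hα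
    refine ⟨fun x y => by rw [h, h, inner_sRefl_sRefl h0], fun β => ?_⟩
    rw [h]
    refine ⟨fun hβ => ?_, R.refl_mem α hα β⟩
    rw [← sRefl_sRefl h0 β]
    exact R.refl_mem α hα _ hβ
  | one => exact ⟨fun _ _ => rfl, fun _ => Iff.rfl⟩
  | mul a b _ _ ha hb =>
    refine ⟨fun x y => ?_, fun α => ?_⟩
    · rw [LinearEquiv.mul_apply, LinearEquiv.mul_apply, ha.1, hb.1]
    · rw [LinearEquiv.mul_apply, ha.2, hb.2]
  | inv a _ ha =>
    have key : ∀ x, a (a⁻¹ x) = x := fun x => a.apply_symm_apply x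
    refine ⟨fun x y => ?_, fun α => ?_⟩
    · rw [← ha.1, key, key]
    · rw [← ha.2, key]

lemma weyl_inner {w : V ≃ₗ[ℝ] V} (hw : w ∈ weylGroup R) (x y : V) : ⟪w x, w y⟫ = ⟪x, y⟫ :=
  (R.weyl_inner_and_mem hw).1 x y

lemma weyl_mem_iff {w : V ≃ₗ[ℝ] V} (hw : w ∈ weylGroup R) (α : V) :
    w α ∈ R.roots ↔ α ∈ R.roots :=
  (R.weyl_inner_and_mem hw).2 α

lemma weyl_norm {w : V ≃ₗ[ℝ] V} (hw : w ∈ weylGroup R) (x : V) : ‖w x‖ = ‖x‖ := by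
  rw [@norm_eq_sqrt_real_inner V, @norm_eq_sqrt_real_inner V, R.weyl_inner hw]

lemma weyl_coroot {w : V ≃ₗ[ℝ] V} (hw : w ∈ weylGroup R) (α : V) :
    coroot (w α) = w (coroot α) := by
  rw [coroot, coroot, R.weyl_norm hw, map_smul]

lemma weyl_inner_coroot {w : V ≃ₗ[ℝ] V} (hw : w ∈ weylGroup R) (x α : V) :
    ⟪w x, coroot (w α)⟫ = ⟪x, coroot α⟫ := by
  rw [R.weyl_coroot hw, R.weyl_inner hw]

lemma weyl_inner_coroot_left {w : V ≃ₗ[ℝ] V} (hw : w ∈ weylGroup R) (x α : V) :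
    ⟪w x, coroot α⟫ = ⟪x, coroot (w⁻¹ α)⟫ := by
  rw [← R.weyl_inner_coroot hw x (w⁻¹ α)]
  congr 2
  exact (w.apply_symm_apply α).symm

lemma isWeight_weyl {w : V ≃ₗ[ℝ] V} (hw : w ∈ weylGroup R) {μ : V} (hμ : IsWeight R μ) :
    IsWeight R (w μ) := fun α hα => by
  rw [R.weyl_inner_coroot_left hw]
  exact hμ _ ((R.weyl_mem_iff (inv_mem hw) α).2 hα)

/-- A vector pairing to `1` with every simple root. -/
lemma exists_inner_simples_eq_one : ∃ δ : V, ∀ γ ∈ R.simples, ⟪γ, δ⟫ = 1 := by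
  let b := Module.Basis.extend R.simples_indep.linearIndepOn_id
  let f : V →ₗ[ℝ] ℝ := b.constr ℝ fun _ => (1 : ℝ)
  refine ⟨(InnerProductSpace.toDual ℝ V).symm (LinearMap.toContinuousLinearMap f), fun γ hγ => ?_⟩
  rw [real_inner_comm, InnerProductSpace.toDual_symm_apply]
  have hmem : γ ∈ R.simples_indep.linearIndepOn_id.extend (Set.subset_univ _) :=
    R.simples_indep.linearIndepOn_id.subset_extend _ ⟨⟨γ, hγ⟩, rfl⟩
  have h1 : f (b ⟨γ, hmem⟩) = 1 := by simp [f]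
  rwa [Module.Basis.extend_apply_self] at h1

lemma inner_combo_nonneg {x v : V} (hv : ∀ γ ∈ R.simples, 0 ≤ ⟪γ, v⟫)
    (hx : ∃ c : V → ℝ, (∀ β, 0 ≤ c β) ∧ x = ∑ β ∈ R.simples, c β • β) : 0 ≤ ⟪x, v⟫ := by
  obtain ⟨c, hc, rfl⟩ := hx
  rw [sum_inner]
  refine Finset.sum_nonneg fun γ hγ => ?_
  rw [real_inner_smul_left]
  exact mul_nonneg (hc γ) (hv γ hγ)

section Height

variable {R} {δ : V} (hδ : ∀ γ ∈ R.simples, ⟪γ, δ⟫ = 1)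
include hδ

lemma inner_pos_of_mem_pos {α : V} (hα : α ∈ R.pos) : 0 < ⟪α, δ⟫ := by
  obtain ⟨c, hc, h⟩ := R.pos_combo α hα
  have hsum : ⟪α, δ⟫ = ∑ γ ∈ R.simples, c γ := by
    rw [h, sum_inner]
    exact Finset.sum_congr rfl fun γ hγ => by rw [real_inner_smul_left, hδ γ hγ, mul_one]
  rw [hsum]
  refine lt_of_le_of_ne (Finset.sum_nonneg fun γ _ => hc γ) fun h0 => ?_
  have hz := (Finset.sum_eq_zero_iff_of_nonneg fun γ _ => hc γ).1 h0.symm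
  refine R.ne_zero α (R.pos_sub hα) ?_
  rw [h]
  exact Finset.sum_eq_zero fun γ hγ => by rw [hz γ hγ, zero_smul]

lemma mem_pos_of_inner_nonneg {α : V} (hα : α ∈ R.roots) (h : 0 ≤ ⟪α, δ⟫) : α ∈ R.pos := by
  rcases R.pos_or_neg α hα with h1 | h1
  · exact h1.1
  · have := inner_pos_of_mem_pos hδ h1.2
    rw [inner_neg_left] at this
    linarith

lemma inner_le_inner_hroot {α : V} (hα : α ∈ R.roots) : ⟪α, δ⟫ ≤ ⟪R.hroot, δ⟫ := by
  have := R.inner_combo_nonneg (v := δ) (fun γ hγ => by rw [hδ γ hγ]; exact zero_le_one)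
    (R.hroot_highest α hα)
  rw [inner_sub_left] at this
  linarith

lemma dominant_of_forall_inner_le {β γ : V} (hγ : γ ∈ R.simples)
    (h : ⟪sRefl γ β, δ⟫ ≤ ⟪β, δ⟫) : 0 ≤ ⟪γ, β⟫ := by
  have h0 : ‖γ‖ ≠ 0 := norm_ne_zero_iff.mpr (R.ne_zero γ (R.simples_sub hγ))
  have hp : 0 < 2 / ‖γ‖ ^ 2 := by positivity
  rw [real_inner_comm, inner_sRefl, real_inner_comm γ δ, hδ γ hγ, real_inner_comm β δ] at h
  by_contra! hneg
  nlinarith [mul_neg_of_pos_of_neg hp hneg]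

end Height

lemma norm_le_norm_hroot {α : V} (hα : α ∈ R.roots) : ‖α‖ ≤ ‖R.hroot‖ := by
  classical
  obtain ⟨δ, hδ⟩ := R.exists_inner_simples_eq_one
  obtain ⟨β, hβ, hmax⟩ := (R.roots.filter fun β => ‖β‖ = ‖α‖).exists_max_image
    (fun β => ⟪β, δ⟫) ⟨α, Finset.mem_filter.2 ⟨hα, rfl⟩⟩
  rw [Finset.mem_filter] at hβ
  have hβdom : ∀ γ ∈ R.simples, 0 ≤ ⟪γ, β⟫ := fun γ hγ => by
    have hγ' := R.simples_sub hγ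
    refine dominant_of_forall_inner_le hδ hγ (hmax _ (Finset.mem_filter.2
      ⟨R.refl_mem γ hγ' β hβ.1, ?_⟩))
    rw [← hβ.2]
    exact R.weyl_norm (R.sReflEquiv_mem hγ') β
  have hφdom : ∀ γ ∈ R.simples, 0 ≤ ⟪γ, R.hroot⟫ := fun γ hγ =>
    dominant_of_forall_inner_le hδ hγ
      (inner_le_inner_hroot hδ (R.refl_mem γ (R.simples_sub hγ) _ R.hroot_mem))
  have key := R.inner_combo_nonneg (v := R.hroot + β)
    (fun γ hγ => by rw [inner_add_right]; exact add_nonneg (hφdom γ hγ) (hβdom γ hγ))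
    (R.hroot_highest β hβ.1)
  rw [real_inner_comm, inner_sub_right, inner_add_left, inner_add_left,
    real_inner_comm R.hroot β, real_inner_self_eq_norm_sq, real_inner_self_eq_norm_sq] at key
  rw [← hβ.2]
  exact abs_le_of_sq_le_sq' (by linarith) (norm_nonneg _) |>.2

lemma exists_weyl_hroot_inner_ne_zero {α : V} (hα : α ∈ R.roots) :
    ∃ w ∈ weylGroup R, ⟪w R.hroot, α⟫ ≠ 0 := by
  classical
  by_contra! hcon
  have h := R.irreducible (R.roots.filter fun α => ∀ w ∈ weylGroup R, ⟪w R.hroot, α⟫ = 0)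
    (Finset.filter_subset _ _) fun a ha b hb hbn => by
      rw [Finset.mem_filter] at ha hbn
      push Not at hbn
      obtain ⟨w, hw, hne⟩ := hbn hb
      have h1 := ha.2 _ (mul_mem (R.sReflEquiv_mem hb) hw)
      have h0 : ‖b‖ ≠ 0 := norm_ne_zero_iff.mpr (R.ne_zero b hb)
      rw [LinearEquiv.mul_apply, sReflEquiv_apply, real_inner_comm, inner_sRefl,
        real_inner_comm (w R.hroot) a, ha.2 w hw, real_inner_comm, zero_sub, neg_eq_zero] at h1
      have hp : 2 / ‖b‖ ^ 2 ≠ 0 := by positivity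
      rcases mul_eq_zero.1 h1 with h2 | h2
      · exact absurd h2 (mul_ne_zero hp hne)
      · exact h2
  rcases h with h | h
  · have : α ∈ R.roots.filter fun α => ∀ w ∈ weylGroup R, ⟪w R.hroot, α⟫ = 0 :=
      Finset.mem_filter.2 ⟨hα, hcon⟩
    rw [h] at this
    simp at this
  · have := R.hroot_mem
    rw [← h, Finset.mem_filter] at this
    exact R.ne_zero _ R.hroot_mem (inner_self_eq_zero.1 (this.2 1 (one_mem _)))

/-- The Weyl orbit of the short coroot `φ∨` detects weights. -/
lemma isWeight_of_forall_weyl {μ : V}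
    (h : ∀ w ∈ weylGroup R, ∃ n : ℤ, ⟪μ, coroot (w R.hroot)⟫ = n) : IsWeight R μ := by
  intro α hα
  obtain ⟨w, hw, hne⟩ := R.exists_weyl_hroot_inner_ne_zero hα
  have hβ : w R.hroot ∈ R.roots := (R.weyl_mem_iff hw _).2 R.hroot_mem
  obtain ⟨n, hn⟩ := h w hw
  obtain ⟨n', hn'⟩ := h _ (mul_mem (R.sReflEquiv_mem hα) hw)
  obtain ⟨t, ht⟩ := R.crystallographic _ hβ α hα
  have hle : ‖α‖ ≤ ‖w R.hroot‖ := by rw [R.weyl_norm hw]; exact R.norm_le_norm_hroot hα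
  rw [LinearEquiv.mul_apply, R.weyl_coroot (R.sReflEquiv_mem hα), sReflEquiv_apply, sRefl,
    inner_sub_right, inner_smul_right, ht, hn] at hn'
  generalize w R.hroot = β at *
  have hβ0 : 0 < ‖β‖ := norm_pos_iff.2 (R.ne_zero β hβ)
  have hsq : ‖α‖ ^ 2 ≤ ‖β‖ ^ 2 := by gcongr
  have hαβ : 2 * ⟪α, β⟫ = t * ‖β‖ ^ 2 := by
    rw [← ht, inner_coroot]
    field_simp
  have ht0 : t ≠ 0 := by
    rintro rfl
    rw [real_inner_comm] at hne
    apply hne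
    simpa using hαβ
  by_cases h2 : 2 ≤ t
  · have h2' : (2 : ℝ) ≤ t := by exact_mod_cast h2
    have : ‖α - β‖ ^ 2 ≤ 0 := by
      rw [norm_sub_sq_real]
      nlinarith [sq_nonneg ‖β‖]
    have h0 : α - β = 0 := by
      rw [← norm_eq_zero]
      exact pow_eq_zero_iff (two_ne_zero) |>.1 (le_antisymm this (sq_nonneg _))
    rw [sub_eq_zero.1 h0]
    exact ⟨n, hn⟩
  by_cases h3 : t ≤ -2
  · have h3' : (t : ℝ) ≤ -2 := by exact_mod_cast h3
    have : ‖α + β‖ ^ 2 ≤ 0 := by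
      rw [norm_add_sq_real]
      nlinarith [sq_nonneg ‖β‖]
    have h0 : α + β = 0 := by
      rw [← norm_eq_zero]
      exact pow_eq_zero_iff (two_ne_zero) |>.1 (le_antisymm this (sq_nonneg _))
    rw [eq_neg_of_add_eq_zero_left h0, coroot_neg, inner_neg_right, hn]
    exact ⟨-n, by push_cast; rfl⟩
  obtain rfl | rfl : t = 1 ∨ t = -1 := by omega
  · exact ⟨n - n', by push_cast at hn' ⊢; linarith⟩
  · exact ⟨n' - n, by push_cast at hn' ⊢; linarith⟩

lemma even_sum_inner_hroot {m : V → ℕ} (hm : ∀ α ∈ R.pos, ⟪α, coroot R.hroot⟫ = (m α : ℝ)) :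
    Even (∑ α ∈ R.pos, m α) := by
  classical
  obtain ⟨δ, hδ⟩ := R.exists_inner_simples_eq_one
  have hφ0 := R.ne_zero _ R.hroot_mem
  have hg : ∀ α ∈ R.pos, m α ≠ 0 →
      (m α : ℝ) • R.hroot - α ∈ R.pos ∧ m ((m α : ℝ) • R.hroot - α) = m α := by
    intro α hα h0
    have hmem : (m α : ℝ) • R.hroot - α ∈ R.pos := by
      apply mem_pos_of_inner_nonneg hδ
      · have h1 := R.neg_mem (R.refl_mem _ R.hroot_mem α (R.pos_sub hα))
        have h2 : -sRefl R.hroot α = (m α : ℝ) • R.hroot - α := by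
          rw [← hm α hα, inner_coroot, sRefl, coroot, smul_smul, real_inner_comm,
            mul_comm (2 / _)]
          abel
        rwa [h2] at h1
      · rw [inner_sub_left, real_inner_smul_left]
        have h1 := inner_le_inner_hroot hδ (R.pos_sub hα)
        have h2 := inner_pos_of_mem_pos hδ R.hroot_pos
        have h3 : (1 : ℝ) ≤ m α := by exact_mod_cast Nat.one_le_iff_ne_zero.2 h0
        nlinarith
    refine ⟨hmem, ?_⟩
    have h1 := hm _ hmem
    rw [inner_sub_left, real_inner_smul_left, inner_coroot_self hφ0, hm α hα] at h1
    have : (m ((m α : ℝ) • R.hroot - α) : ℝ) = m α := by linarith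
    exact_mod_cast this
  rw [← ZMod.natCast_eq_zero_iff_even, Nat.cast_sum,
    ← Finset.sum_filter_of_ne (p := fun α => m α ≠ 0)
      (fun α _ h => fun h0 => h (by rw [h0, Nat.cast_zero]))]
  refine Finset.sum_involution (fun α _ => (m α : ℝ) • R.hroot - α) ?_ ?_ ?_ ?_
  · intro α hα
    rw [Finset.mem_filter] at hα
    rw [(hg α hα.1 hα.2).2]
    exact CharTwo.add_self_eq_zero _
  · intro α hα hne heq
    rw [Finset.mem_filter] at hα
    have h1 : α = ((m α : ℝ) / 2) • R.hroot := by
      have h2 : (m α : ℝ) • R.hroot = (2 : ℝ) • α := by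
        rw [two_smul]
        exact sub_eq_iff_eq_add.1 heq
      rw [div_eq_inv_mul, mul_smul, h2, smul_smul]
      norm_num
    have h3 : ((m α : ℝ) / 2) • R.hroot ∈ R.roots := h1 ▸ R.pos_sub hα.1
    have h4 : (m α : ℝ) = 2 := by
      have : (0 : ℝ) ≤ m α := Nat.cast_nonneg _
      rcases R.reduced _ R.hroot_mem _ h3 with h | h <;> linarith
    have h5 : m α = 2 := by exact_mod_cast h4
    rw [h5] at hne
    exact hne rfl
  · intro α hα
    rw [Finset.mem_filter] at hα ⊢
    obtain ⟨h1, h2⟩ := hg α hα.1 hα.2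
    exact ⟨h1, by rw [h2]; exact hα.2⟩
  · intro α hα
    rw [Finset.mem_filter] at hα
    simp only [(hg α hα.1 hα.2).2]
    abel

variable {R} {k : V → ℝ} (hk : IsMultiplicity R k)
include hk

lemma multiplicity_neg {α : V} (hα : α ∈ R.roots) : k (-α) = k α := by
  rw [← sRefl_self (R.ne_zero α hα)]
  exact hk.2 _ (R.sReflEquiv_mem hα) α hα

lemma sigmaFun_weyl {w : V ≃ₗ[ℝ] V} (hw : w ∈ weylGroup R) (η : V) :
    sigmaFun R k (w η) = w (sigmaFun R k η) := by
  rw [sigmaFun, sigmaFun, map_sum]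
  symm
  refine Finset.sum_bij (fun α _ => w α) (fun α hα => (R.weyl_mem_iff hw α).2 hα)
    (fun _ _ _ _ h => w.injective h) (fun β hβ => ⟨w.symm β, ?_, w.apply_symm_apply β⟩)
    fun α hα => ?_
  · rw [← R.weyl_mem_iff hw, w.apply_symm_apply]
    exact hβ
  · rw [map_smul, R.weyl_inner_coroot hw, hk.2 w hw α hα]

lemma inner_sub_sigmaFun_sub_nonneg (x y : V) :
    0 ≤ ⟪x - y, sigmaFun R k x - sigmaFun R k y⟫ := by
  rw [sigmaFun, sigmaFun, ← Finset.sum_sub_distrib, inner_sum]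
  refine Finset.sum_nonneg fun α hα => ?_
  have hkα := hk.1 α hα
  have h0 : ‖α‖ ≠ 0 := norm_ne_zero_iff.mpr (R.ne_zero α hα)
  have hc : 0 < 2 / ‖α‖ ^ 2 := by positivity
  rw [← sub_smul, inner_smul_right, inner_sub_left, inner_coroot, inner_coroot]
  rcases le_total ⟪x, α⟫ ⟪y, α⟫ with h | h
  · refine mul_nonneg_of_nonpos_of_nonpos (sub_nonpos.2 (Real.arctan_strictMono.monotone ?_))
      (sub_nonpos.2 h)
    gcongr
  · refine mul_nonneg (sub_nonneg.2 (Real.arctan_strictMono.monotone ?_)) (sub_nonneg.2 h)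
    gcongr

lemma add_sigmaFun_injective : Function.Injective fun η => η + sigmaFun R k η := by
  intro x y h
  have h1 := inner_sub_sigmaFun_sub_nonneg hk x y
  have h2 : sigmaFun R k x - sigmaFun R k y = -(x - y) := by
    have h' : x + sigmaFun R k x = y + sigmaFun R k y := h
    rw [eq_sub_of_add_eq' h']
    abel
  rw [h2, inner_neg_right, real_inner_self_eq_norm_sq] at h1
  have h3 : ‖x - y‖ = 0 :=
    pow_eq_zero_iff (two_ne_zero) |>.1 (le_antisymm (by linarith) (sq_nonneg _))
  exact sub_eq_zero.1 (norm_eq_zero.1 h3)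

lemma sigmaFun_eq_sum_pos (η : V) :
    sigmaFun R k η = ∑ α ∈ R.pos, (2 * Real.arctan (⟪η, coroot α⟫ / k α)) • α := by
  classical
  have hneg : ∑ α ∈ R.roots \ R.pos, Real.arctan (⟪η, coroot α⟫ / k α) • α =
      ∑ α ∈ R.pos, Real.arctan (⟪η, coroot α⟫ / k α) • α := by
    refine Finset.sum_nbij' (fun α => -α) (fun α => -α) ?_ ?_ (by simp) (by simp) ?_
    · intro α hα
      rw [Finset.mem_sdiff] at hα
      rcases R.pos_or_neg α hα.1 with h | h
      · exact absurd h.1 hα.2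
      · exact h.2
    · intro α hα
      rw [Finset.mem_sdiff]
      refine ⟨R.neg_mem (R.pos_sub hα), ?_⟩
      rcases R.pos_or_neg α (R.pos_sub hα) with h | h
      · exact h.2
      · exact absurd hα h.1
    · intro α hα
      rw [multiplicity_neg hk (Finset.mem_sdiff.1 hα).1, coroot_neg, inner_neg_right, neg_div,
        Real.arctan_neg, neg_smul_neg]
  rw [sigmaFun, ← Finset.sum_sdiff R.pos_sub, hneg, ← Finset.sum_add_distrib]
  exact Finset.sum_congr rfl fun α _ => by rw [two_mul, add_smul]

lemma prod_phase_eq_exp {m : V → ℕ} (hm : ∀ α ∈ R.pos, ⟪α, coroot R.hroot⟫ = (m α : ℝ))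
    (η : V) :
    ∏ α ∈ R.pos, ((Complex.I * (⟪η, coroot α⟫ : ℝ) - (k α : ℂ)) /
         (Complex.I * (⟪η, coroot α⟫ : ℝ) + (k α : ℂ))) ^ (m α) =
      Complex.exp (-(Complex.I * (⟪sigmaFun R k η, coroot R.hroot⟫ : ℝ))) := by
  have h1 : ∀ α ∈ R.pos, ((Complex.I * (⟪η, coroot α⟫ : ℝ) - (k α : ℂ)) /
      (Complex.I * (⟪η, coroot α⟫ : ℝ) + (k α : ℂ))) ^ (m α) =
      (-1) ^ m α * Complex.exp (-(Complex.I *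
        (⟪(2 * Real.arctan (⟪η, coroot α⟫ / k α)) • α, coroot R.hroot⟫ : ℝ))) := by
    intro α hα
    rw [Complex.I_mul_sub_div_I_mul_add _ (hk.1 α (R.pos_sub hα)), neg_pow, ← Complex.exp_nat_mul,
      real_inner_smul_left, hm α hα]
    congr 2
    push_cast
    ring
  rw [Finset.prod_congr rfl h1, Finset.prod_mul_distrib, Finset.prod_pow_eq_pow_sum,
    (R.even_sum_inner_hroot hm).neg_one_pow, one_mul, ← Complex.exp_sum,
    sigmaFun_eq_sum_pos hk, sum_inner]
  congr 1
  push_cast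
  rw [Finset.mul_sum, Finset.sum_neg_distrib]

/-- Taking logarithms in the Bethe equations. -/
lemma isBetheRoot_iff {m : V → ℕ} (hm : ∀ α ∈ R.pos, ⟪α, coroot R.hroot⟫ = (m α : ℝ))
    (η : V) : IsBetheRoot R k m η ↔ ∀ w ∈ weylGroup R, ∃ n : ℤ,
      ⟪w (η + sigmaFun R k η), coroot R.hroot⟫ = 2 * Real.pi * n := by
  refine forall₂_congr fun w hw => ?_
  rw [prod_phase_eq_exp hk hm, Complex.exp_eq_exp_iff_exists_int, sigmaFun_weyl hk hw, map_add,
    inner_add_left]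
  refine exists_congr fun n => ?_
  rw [← Complex.ofReal_inj]
  push_cast
  constructor
  · intro h
    apply mul_left_cancel₀ Complex.I_ne_zero
    linear_combination h
  · intro h
    linear_combination Complex.I * h

lemma isBetheRoot_iff_isWeight {m : V → ℕ}
    (hm : ∀ α ∈ R.pos, ⟪α, coroot R.hroot⟫ = (m α : ℝ)) {η μ : V}
    (h : η + sigmaFun R k η = (2 * Real.pi) • μ) : IsBetheRoot R k m η ↔ IsWeight R μ := by
  have hpi : 2 * Real.pi ≠ 0 := by positivity
  rw [isBetheRoot_iff hk hm, h]
  constructor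
  · intro hB
    refine R.isWeight_of_forall_weyl fun w hw => ?_
    obtain ⟨n, hn⟩ := hB w⁻¹ (inv_mem hw)
    rw [R.weyl_inner_coroot_left (inv_mem hw), inv_inv, real_inner_smul_left] at hn
    exact ⟨n, mul_left_cancel₀ hpi hn⟩
  · intro hμ w hw
    obtain ⟨n, hn⟩ := R.isWeight_weyl hw hμ _ R.hroot_mem
    exact ⟨n, by rw [map_smul, real_inner_smul_left, hn]⟩

end RootSystemBase

end

/-- The map `μ ↦ μ̂_k` (characterized by `μ̂_k + σ_{μ̂_k}^k = 2πμ`) is a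
`W₀`-equivariant bijection from the weight lattice `P` onto the set of Bethe roots. -/
theorem statement3
    {V : Type*} [NormedAddCommGroup V] [InnerProductSpace ℝ V] [FiniteDimensional ℝ V]
    (R : RootSystemBase V) (k : V → ℝ) (hk : IsMultiplicity R k)
    (m : V → ℕ) (hm : ∀ α ∈ R.pos, ⟪α, coroot R.hroot⟫ = (m α : ℝ))
    (hat : V → V)
    (hhat : ∀ μ : V, IsWeight R μ →
      hat μ + sigmaFun R k (hat μ) = (2 * Real.pi) • μ) :
    (∀ μ : V, IsWeight R μ → IsBetheRoot R k m (hat μ)) ∧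
    (∀ μ μ' : V, IsWeight R μ → IsWeight R μ' → hat μ = hat μ' → μ = μ') ∧
    (∀ η : V, IsBetheRoot R k m η → ∃ μ : V, IsWeight R μ ∧ hat μ = η) ∧
    (∀ w : V ≃ₗ[ℝ] V, w ∈ weylGroup R → ∀ μ : V, IsWeight R μ →
      hat (w μ) = w (hat μ)) := by
  have hpi : 2 * Real.pi ≠ 0 := by positivity
  refine ⟨fun μ hμ => (RootSystemBase.isBetheRoot_iff_isWeight hk hm (hhat μ hμ)).2 hμ,
    fun μ μ' hμ hμ' h => ?_, fun η hη => ?_, fun w hw μ hμ => ?_⟩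
  · have h1 := hhat μ hμ
    rw [h, hhat μ' hμ'] at h1
    exact (smul_right_injective V hpi h1).symm
  · have h : η + sigmaFun R k η = (2 * Real.pi) • ((2 * Real.pi)⁻¹ • (η + sigmaFun R k η)) :=
      (smul_inv_smul₀ hpi _).symm
    have hμ := (RootSystemBase.isBetheRoot_iff_isWeight hk hm h).1 hη
    exact ⟨_, hμ, RootSystemBase.add_sigmaFun_injective hk ((hhat _ hμ).trans h.symm)⟩
  · apply RootSystemBase.add_sigmaFun_injective hk
    change hat (w μ) + sigmaFun R k (hat (w μ)) = w (hat μ) + sigmaFun R k (w (hat μ))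
    rw [hhat _ (R.isWeight_weyl hw hμ), RootSystemBase.sigmaFun_weyl hk hw, ← map_add, hhat μ hμ,
      map_smul]

end
end

section
/- For every μ ∈ P, the minimizer μ̂_k lies in the closed dominant chamber C̄ if and only if μ ∈ P⁺. -/
open scoped BigOperators
open RealInnerProductSpace

noncomputable section

section

variable {V : Type*} [NormedAddCommGroup V] [InnerProductSpace ℝ V]

/-- Coroots are equivariant under linear isometries. -/
theorem coroot_map (r : V ≃ₗᵢ[ℝ] V) (α : V) : coroot (r α) = r (coroot α) := by
  simp [coroot]

/-- The reflection `s_β` as Mathlib's orthogonal reflection. -/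
theorem reflection_eq_sRefl (β v : V) : (ℝ ∙ β)ᗮ.reflection v = sRefl β v := by
  rw [Submodule.reflection_orthogonal_apply, Submodule.reflection_singleton_apply, sRefl, coroot]
  simp only [RCLike.ofReal_real_eq_id, id_eq, smul_smul, neg_sub]
  rw [← Nat.cast_smul_eq_nsmul ℝ, smul_smul]
  congr 2
  push_cast
  ring

/-- `v − s_β v = v(β∨)·β`. -/
theorem sub_reflection_eq (β v : V) : v - (ℝ ∙ β)ᗮ.reflection v = ⟪v, coroot β⟫ • β := by
  rw [reflection_eq_sRefl, sRefl, sub_sub_cancel, coroot, inner_smul_right, smul_smul,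
    real_inner_comm, mul_comm]

variable [FiniteDimensional ℝ V]

/-- Equivariance of `η ↦ σ_η^k` under the reflections in the roots. -/
theorem sigmaFun_reflection (R : RootSystemBase V) {k : V → ℝ} (hk : IsMultiplicity R k)
    {β : V} (hβ : β ∈ R.roots) (η : V) :
    sigmaFun R k ((ℝ ∙ β)ᗮ.reflection η) = (ℝ ∙ β)ᗮ.reflection (sigmaFun R k η) := by
  set r := (ℝ ∙ β)ᗮ.reflection with hr
  have hmem : ∀ α ∈ R.roots, r α ∈ R.roots := fun α hα => by
    rw [hr, reflection_eq_sRefl]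
    exact R.refl_mem β hβ α hα
  have hkr : ∀ α ∈ R.roots, k (r α) = k α := hk.2 r.toLinearEquiv
    (Subgroup.subset_closure ⟨β, hβ, fun v => reflection_eq_sRefl β v⟩)
  have hrr : ∀ v, r (r v) = v := Submodule.reflection_reflection _
  simp only [sigmaFun, map_sum, map_smul]
  refine (Finset.sum_bij' (fun α _ => r α) (fun α _ => r α) hmem hmem
    (fun α _ => hrr α) (fun α _ => hrr α) fun α hα => ?_).symm
  rw [coroot_map, r.inner_map_map, hkr α hα]

/-- The map `η ↦ σ_η^k` is monotone. -/
theorem inner_sigmaFun_sub_nonneg (R : RootSystemBase V) {k : V → ℝ}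
    (hk : ∀ α ∈ R.roots, 0 < k α) (η ζ : V) :
    0 ≤ ⟪sigmaFun R k η - sigmaFun R k ζ, η - ζ⟫ := by
  rw [sigmaFun, sigmaFun, ← Finset.sum_sub_distrib, sum_inner]
  refine Finset.sum_nonneg fun α hα => ?_
  have hα0 : 0 < ‖α‖ := norm_pos_iff.2 (R.ne_zero α hα)
  have hpair : ∀ v : V, ⟪α, v⟫ = ‖α‖ ^ 2 / 2 * ⟪v, coroot α⟫ := fun v => by
    rw [coroot, inner_smul_right, real_inner_comm]
    field_simp
  rw [← sub_smul, real_inner_smul_left, hpair, inner_sub_left, mul_left_comm]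
  refine mul_nonneg (by positivity) ?_
  have hkα := hk α hα
  rcases le_total ⟪η, coroot α⟫ ⟪ζ, coroot α⟫ with h | h
  · exact mul_nonneg_of_nonpos_of_nonpos
      (sub_nonpos.2 (Real.arctan_mono (by gcongr))) (sub_nonpos.2 h)
  · exact mul_nonneg (sub_nonneg.2 (Real.arctan_mono (by gcongr))) (sub_nonneg.2 h)

/-- The gradient map `η ↦ η + σ_η^k` preserves the closed half-space of every root,
and so does its inverse. -/
theorem inner_coroot_nonneg_iff (R : RootSystemBase V) {k : V → ℝ} (hk : IsMultiplicity R k)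
    {β : V} (hβ : β ∈ R.roots) (η : V) :
    0 ≤ ⟪η, coroot β⟫ ↔ 0 ≤ ⟪η + sigmaFun R k η, coroot β⟫ := by
  have hβ0 : 0 < ‖β‖ := norm_pos_iff.2 (R.ne_zero β hβ)
  have hmono := inner_sigmaFun_sub_nonneg R hk.1 η ((ℝ ∙ β)ᗮ.reflection η)
  rw [sigmaFun_reflection R hk hβ, sub_reflection_eq, sub_reflection_eq, real_inner_smul_left,
    real_inner_smul_right, real_inner_self_eq_norm_sq, ← mul_assoc] at hmono
  have hprod := nonneg_of_mul_nonneg_left hmono (by positivity)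
  rw [inner_add_left]
  rcases lt_trichotomy ⟪η, coroot β⟫ 0 with h | h | h
  · have := nonpos_of_mul_nonneg_left hprod h
    constructor <;> intro <;> linarith
  · have hfix : (ℝ ∙ β)ᗮ.reflection η = η := by
      have := sub_reflection_eq β η
      rw [h, zero_smul, sub_eq_zero] at this
      exact this.symm
    have hσ := sub_reflection_eq β (sigmaFun R k η)
    rw [← sigmaFun_reflection R hk hβ, hfix, sub_self, eq_comm, smul_eq_zero] at hσ
    simp [h, hσ.resolve_right (R.ne_zero β hβ)]
  · have := nonneg_of_mul_nonneg_left hprod h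
    constructor <;> intro <;> linarith

end

/-- For every weight `μ ∈ P`, the minimizer `μ̂_k` lies in the closed
dominant chamber iff `μ ∈ P⁺`. -/
theorem statement7
    {V : Type*} [NormedAddCommGroup V] [InnerProductSpace ℝ V] [FiniteDimensional ℝ V]
    (R : RootSystemBase V) (k : V → ℝ) (hk : IsMultiplicity R k)
    (hat : V → V)
    (hhat : ∀ μ : V, IsWeight R μ →
      hat μ + sigmaFun R k (hat μ) = (2 * Real.pi) • μ)
    (μ : V) (hμ : IsWeight R μ) :
    (∀ β ∈ R.pos, 0 ≤ ⟪hat μ, coroot β⟫) ↔ (∀ β ∈ R.pos, 0 ≤ ⟪μ, coroot β⟫) := by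
  refine forall₂_congr fun β hβ => ?_
  rw [inner_coroot_nonneg_iff R hk (R.pos_sub hβ), hhat μ hμ, real_inner_smul_left]
  exact mul_nonneg_iff_of_pos_left Real.two_pi_pos

end
end
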